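/- Suppose (γ,ℓ⁺,ℓ⁻) and (γ̄,ℓ̄⁺,ℓ̄⁻) : I → ℝ³₁ × Δ₄ are lightcone framed curves that are (n,n̄)-mates with γ̄(t) = γ(t) + λ(t)n(t), where n = −(1/2)ℓ⁺ ∧ ℓ⁻ and n̄ = −(1/2)ℓ̄⁺ ∧ ℓ̄⁻. Then λ is a non-zero constant function. -/

import Mathlib

open Matrix

noncomputable section

/-- The Minkowski pseudo-scalar product on `ℝ³`:
`⟨x,y⟩ = −x₁y₁ + x₂y₂ + x₃y₃`. -/
def mdot (x y : Fin 3 → ℝ) : ℝ := -(x 0 * y 0) + x 1 * y 1 + x 2 * y 2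

/-- The pseudo vector product `x ∧ y` on Minkowski `ℝ³`, i.e. the determinant of the
matrix with rows `(−e₁, e₂, e₃)`, `x`, `y`. -/
def mcross (x y : Fin 3 → ℝ) : Fin 3 → ℝ :=
  ![-(x 1 * y 2 - x 2 * y 1), x 2 * y 0 - x 0 * y 2, x 0 * y 1 - x 1 * y 0]

/-- The (punctured) lightcone `LC* = {x ≠ 0 : ⟨x,x⟩ = 0}`. -/
def LCstar (x : Fin 3 → ℝ) : Prop := x ≠ 0 ∧ mdot x x = 0

/-- Membership in `Δ₄ = {(v,w) ∈ LC* × LC* : ⟨v,w⟩ = −2}`. -/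
def MemDelta4 (v w : Fin 3 → ℝ) : Prop := LCstar v ∧ LCstar w ∧ mdot v w = -2

/-- `n(t) = −(1/2) ℓ⁺(t) ∧ ℓ⁻(t)`. -/
def lcn (lp lm : ℝ → Fin 3 → ℝ) : ℝ → Fin 3 → ℝ :=
  fun t => (-(1/2) : ℝ) • mcross (lp t) (lm t)

/-- Smoothness (on `I`) of a real valued function. -/
def Smooth1 (I : Set ℝ) (f : ℝ → ℝ) : Prop := ContDiffOn ℝ (⊤ : ℕ∞) f I

/-- Smoothness (on `I`) of an `ℝ³`-valued function. -/
def Smooth3 (I : Set ℝ) (f : ℝ → Fin 3 → ℝ) : Prop := ContDiffOn ℝ (⊤ : ℕ∞) f I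

/-- `λ ≢ 0` : the set where `λ` is non-zero is dense in `I`. -/
def NotIdentZero (I : Set ℝ) (f : ℝ → ℝ) : Prop :=
  I ⊆ closure {t | t ∈ I ∧ f t ≠ 0}

/-- A lightcone framed curve `(γ, ℓ⁺, ℓ⁻) : I → ℝ³₁ × Δ₄`. -/
structure IsLightconeFramedCurve (I : Set ℝ) (γ lp lm : ℝ → Fin 3 → ℝ) : Prop where
  smooth_base : Smooth3 I γ
  smooth_lp : Smooth3 I lp
  smooth_lm : Smooth3 I lm
  delta4 : ∀ t ∈ I, MemDelta4 (lp t) (lm t)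
  exists_coeffs : ∃ α β : ℝ → ℝ, Smooth1 I α ∧ Smooth1 I β ∧
    ∀ t ∈ I, deriv γ t = α t • lp t + β t • lm t

/-- `(κ₁, κ₂, κ₃, α, β)` is the lightcone curvature of the lightcone framed curve
`(γ, ℓ⁺, ℓ⁻)`. -/
structure HasLightconeCurvature (I : Set ℝ) (γ lp lm : ℝ → Fin 3 → ℝ)
    (κ₁ κ₂ κ₃ α β : ℝ → ℝ) : Prop where
  smooth_κ₁ : Smooth1 I κ₁
  smooth_κ₂ : Smooth1 I κ₂
  smooth_κ₃ : Smooth1 I κ₃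
  smooth_α : Smooth1 I α
  smooth_β : Smooth1 I β
  deriv_lp : ∀ t ∈ I, deriv lp t = κ₁ t • lp t + (2 * κ₃ t) • lcn lp lm t
  deriv_lm : ∀ t ∈ I, deriv lm t = (-κ₁ t) • lm t + (2 * κ₂ t) • lcn lp lm t
  deriv_n : ∀ t ∈ I, deriv (lcn lp lm) t = κ₂ t • lp t + κ₃ t • lm t
  deriv_base : ∀ t ∈ I, deriv γ t = α t • lp t + β t • lm t

/-- The vector field `ℓ⁺` built from a lightcone frame. -/
def fieldLp (lp lm : ℝ → Fin 3 → ℝ) : ℝ → Fin 3 → ℝ := fun t => lp t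
/-- The vector field `ℓ⁻` built from a lightcone frame. -/
def fieldLm (lp lm : ℝ → Fin 3 → ℝ) : ℝ → Fin 3 → ℝ := fun t => lm t
/-- `nᵀ = (ℓ⁺ + ℓ⁻)/2`. -/
def fieldNT (lp lm : ℝ → Fin 3 → ℝ) : ℝ → Fin 3 → ℝ := fun t => (1/2 : ℝ) • (lp t + lm t)
/-- `nˢ = (ℓ⁺ − ℓ⁻)/2`. -/
def fieldNS (lp lm : ℝ → Fin 3 → ℝ) : ℝ → Fin 3 → ℝ := fun t => (1/2 : ℝ) • (lp t - lm t)
/-- `n = −(1/2) ℓ⁺ ∧ ℓ⁻`. -/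
def fieldN (lp lm : ℝ → Fin 3 → ℝ) : ℝ → Fin 3 → ℝ := lcn lp lm
/-- `ℓ̃⁺ = nᵀ + n`. -/
def fieldLtp (lp lm : ℝ → Fin 3 → ℝ) : ℝ → Fin 3 → ℝ :=
  fun t => fieldNT lp lm t + fieldN lp lm t
/-- `ℓ̃⁻ = nᵀ − n`. -/
def fieldLtm (lp lm : ℝ → Fin 3 → ℝ) : ℝ → Fin 3 → ℝ :=
  fun t => fieldNT lp lm t - fieldN lp lm t

/-- `(γ,ℓ⁺,ℓ⁻)` and `(γ̄,ℓ̄⁺,ℓ̄⁻)` are `(v,w̄)`-mates. -/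
def AreMates (I : Set ℝ)
    (v w : (ℝ → Fin 3 → ℝ) → (ℝ → Fin 3 → ℝ) → ℝ → Fin 3 → ℝ)
    (γ lp lm γ' lp' lm' : ℝ → Fin 3 → ℝ) : Prop :=
  IsLightconeFramedCurve I γ lp lm ∧ IsLightconeFramedCurve I γ' lp' lm' ∧
  ∃ lam : ℝ → ℝ, Smooth1 I lam ∧ NotIdentZero I lam ∧
    (∀ t ∈ I, γ' t = γ t + lam t • v lp lm t) ∧
    (∀ t ∈ I, v lp lm t = w lp' lm' t)

/-- `(γ,ℓ⁺,ℓ⁻)` is a `(v,w̄)`-Bertrand lightcone framed curve. -/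
def IsBertrand (I : Set ℝ)
    (v w : (ℝ → Fin 3 → ℝ) → (ℝ → Fin 3 → ℝ) → ℝ → Fin 3 → ℝ)
    (γ lp lm : ℝ → Fin 3 → ℝ) : Prop :=
  ∃ γ' lp' lm' : ℝ → Fin 3 → ℝ, AreMates I v w γ lp lm γ' lp' lm'

theorem mdot_comm (x y : Fin 3 → ℝ) : mdot x y = mdot y x := by
  simp only [mdot]; ring

theorem mdot_add_left (x y z : Fin 3 → ℝ) : mdot (x + y) z = mdot x z + mdot y z := by
  simp only [mdot, Pi.add_apply]; ring

theorem mdot_smul_left (a : ℝ) (x y : Fin 3 → ℝ) : mdot (a • x) y = a * mdot x y := by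
  simp only [mdot, Pi.smul_apply, smul_eq_mul]; ring

/-- The Minkowski analogue of Lagrange's identity. -/
theorem mdot_mcross_self (x y : Fin 3 → ℝ) :
    mdot (mcross x y) (mcross x y) = mdot x y ^ 2 - mdot x x * mdot y y := by
  simp [mdot, mcross]; ring

theorem mdot_lp_lcn (lp lm : ℝ → Fin 3 → ℝ) (t : ℝ) : mdot (lp t) (lcn lp lm t) = 0 := by
  simp [mdot, lcn, mcross]; ring

theorem mdot_lm_lcn (lp lm : ℝ → Fin 3 → ℝ) (t : ℝ) : mdot (lm t) (lcn lp lm t) = 0 := by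
  simp [mdot, lcn, mcross]; ring

theorem mdot_lcn_self {lp lm : ℝ → Fin 3 → ℝ} {t : ℝ} (h : MemDelta4 (lp t) (lm t)) :
    mdot (lcn lp lm t) (lcn lp lm t) = 1 := by
  obtain ⟨⟨_, hp⟩, ⟨_, hm⟩, hpm⟩ := h
  rw [lcn, mdot_smul_left, mdot_comm, mdot_smul_left, mdot_mcross_self, hp, hm, hpm]
  norm_num

theorem HasDerivAt.mdot {f g : ℝ → Fin 3 → ℝ} {f' g' : Fin 3 → ℝ} {t : ℝ}
    (hf : HasDerivAt f f' t) (hg : HasDerivAt g g' t) :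
    HasDerivAt (fun s => mdot (f s) (g s)) (mdot f' (g t) + mdot (f t) g') t := by
  rw [hasDerivAt_pi] at hf hg
  refine ((((hf 0).fun_mul (hg 0)).fun_neg.fun_add ((hf 1).fun_mul (hg 1))).fun_add
    ((hf 2).fun_mul (hg 2))).congr_deriv ?_
  simp only [_root_.mdot]; ring

theorem DifferentiableAt.lcn {lp lm : ℝ → Fin 3 → ℝ} {t : ℝ}
    (hp : DifferentiableAt ℝ lp t) (hm : DifferentiableAt ℝ lm t) :
    DifferentiableAt ℝ (lcn lp lm) t := by
  rw [differentiableAt_pi] at hp hm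
  have hp0 := hp 0
  have hp1 := hp 1
  have hp2 := hp 2
  have hm0 := hm 0
  have hm1 := hm 1
  have hm2 := hm 2
  rw [differentiableAt_pi]
  intro i
  fin_cases i <;> simp [_root_.lcn, mcross] <;> fun_prop

namespace IsLightconeFramedCurve

variable {I : Set ℝ} {γ lp lm : ℝ → Fin 3 → ℝ}

theorem mdot_deriv_base_lcn (hF : IsLightconeFramedCurve I γ lp lm) {t : ℝ} (ht : t ∈ I) :
    mdot (deriv γ t) (lcn lp lm t) = 0 := by
  obtain ⟨α, β, _, _, h⟩ := hF.exists_coeffs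
  rw [h t ht, mdot_add_left, mdot_smul_left, mdot_smul_left, mdot_lp_lcn, mdot_lm_lcn]
  ring

theorem differentiableAt_base (hF : IsLightconeFramedCurve I γ lp lm) (hI : IsOpen I) {t : ℝ}
    (ht : t ∈ I) : DifferentiableAt ℝ γ t :=
  (hF.smooth_base.contDiffAt (hI.mem_nhds ht)).differentiableAt (by simp)

theorem differentiableAt_lcn (hF : IsLightconeFramedCurve I γ lp lm) (hI : IsOpen I) {t : ℝ}
    (ht : t ∈ I) : DifferentiableAt ℝ (lcn lp lm) t :=
  ((hF.smooth_lp.contDiffAt (hI.mem_nhds ht)).differentiableAt (by simp)).lcn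
    ((hF.smooth_lm.contDiffAt (hI.mem_nhds ht)).differentiableAt (by simp))

theorem mdot_deriv_lcn_lcn (hF : IsLightconeFramedCurve I γ lp lm) (hI : IsOpen I) {t : ℝ}
    (ht : t ∈ I) : mdot (deriv (lcn lp lm) t) (lcn lp lm t) = 0 := by
  have hd := (hF.differentiableAt_lcn hI ht).hasDerivAt
  have hconst : (fun s => mdot (lcn lp lm s) (lcn lp lm s)) =ᶠ[nhds t] fun _ => 1 := by
    filter_upwards [hI.mem_nhds ht] with s hs using mdot_lcn_self (hF.delta4 s hs)
  have := (hd.mdot hd).unique ((hasDerivAt_const t 1).congr_of_eventuallyEq hconst)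
  rw [mdot_comm (lcn lp lm t)] at this
  linarith

end IsLightconeFramedCurve

/-- For `(n,n̄)`-mates with `γ̄ = γ + λ n`, the function `λ` is a non-zero constant. -/
theorem lambda_const_of_n_nbar_mates
    (I : Set ℝ) (hIo : IsOpen I) (hIc : I.OrdConnected)
    (γ lp lm γ' lp' lm' : ℝ → Fin 3 → ℝ)
    (hF : IsLightconeFramedCurve I γ lp lm)
    (hF' : IsLightconeFramedCurve I γ' lp' lm')
    (lam : ℝ → ℝ) (hlam : Smooth1 I lam) (hne : NotIdentZero I lam)
    (hbase : ∀ t ∈ I, γ' t = γ t + lam t • lcn lp lm t)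
    (hn : ∀ t ∈ I, lcn lp lm t = lcn lp' lm' t) :
    ∃ c : ℝ, c ≠ 0 ∧ ∀ t ∈ I, lam t = c := by
  have hderiv : ∀ t ∈ I, HasDerivAt lam 0 t := by
    intro t ht
    have hl := ((hlam.contDiffAt (hIo.mem_nhds ht)).differentiableAt (by simp)).hasDerivAt
    have hsum := (hF.differentiableAt_base hIo ht).hasDerivAt.fun_add
      (hl.fun_smul (hF.differentiableAt_lcn hIo ht).hasDerivAt)
    have heq : γ' =ᶠ[nhds t] fun s => γ s + lam s • lcn lp lm s := by
      filter_upwards [hIo.mem_nhds ht] with s hs using hbase s hs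
    have horth := hF'.mdot_deriv_base_lcn ht
    rw [← hn t ht, (hsum.congr_of_eventuallyEq heq).deriv, mdot_add_left, mdot_add_left,
      mdot_smul_left, mdot_smul_left, hF.mdot_deriv_base_lcn ht, hF.mdot_deriv_lcn_lcn hIo ht,
      mdot_lcn_self (hF.delta4 t ht)] at horth
    have hzero : deriv lam t = 0 := by linarith
    rwa [hzero] at hl
  rcases I.eq_empty_or_nonempty with rfl | ⟨s, hs⟩
  · exact ⟨1, one_ne_zero, by simp⟩
  · obtain ⟨u, hu, hlu⟩ := closure_nonempty_iff.mp ⟨s, hne hs⟩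
    exact ⟨lam u, hlu, fun t ht => hIo.is_const_of_deriv_eq_zero hIc.isPreconnected
      (fun x hx => (hderiv x hx).differentiableAt.differentiableWithinAt)
      (fun x hx => (hderiv x hx).deriv) ht hu⟩
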